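/- Let N, n be positive integers, let ℓ₁, …, ℓₙ : ℝᴺ → ℝ and ℓ : ℝᴺ → ℝ be twice continuously differentiable, and let R(θ) = (1/n) Σᵢ₌₁ⁿ ℓᵢ(θ). Suppose θ : ℝ → ℝᴺ is differentiable at 0, satisfies ∇R(θ(δ)) + δ·∇ℓ(θ(δ)) = 0 for all δ in a neighborhood of 0, and H = ∇²R(θ(0)) is invertible. If L_test : ℝᴺ → ℝ is differentiable at θ̂ = θ(0), then the influence of upweighting ℓ on the test loss is d/dδ L_test(θ(δ))|_{δ=0} = ⟨∇L_test(θ̂), −H⁻¹ ∇ℓ(θ̂)⟩. -/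

import Mathlib

open RealInnerProductSpace

/-- The gradient of a twice continuously differentiable function is differentiable. -/
theorem differentiable_gradient_of_contDiff_two {N : ℕ}
    {f : EuclideanSpace ℝ (Fin N) → ℝ} (hf : ContDiff ℝ 2 f) :
    Differentiable ℝ (gradient f) := by
  have h1 : Differentiable ℝ (fderiv ℝ f) :=
    (hf.fderiv_right (m := 1) (by norm_num)).differentiable (by norm_num)
  intro x
  exact ((InnerProductSpace.toDual ℝ (EuclideanSpace ℝ (Fin N))).symm.toContinuousLinearEquiv
    |>.differentiableAt).comp x (h1 x)

/-- **Influence of upweighting a loss on the test loss.**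
If `θ δ` is a stationary point of the δ-reweighted objective `R + δ • ℓ` for all
`δ` near `0`, `θ` is differentiable at `0`, the Hessian `H = ∇²R(θ 0)` is invertible,
and the test loss `Ltest` is differentiable at `θhat = θ 0`, then
`d/dδ Ltest(θ δ)|₀ = ⟪∇Ltest(θhat), -H⁻¹ ∇ℓ(θhat)⟫`. -/
theorem influence_loss_of_upweighting
    (N n : ℕ) (hN : 0 < N) (hn : 0 < n)
    (ℓi : Fin n → EuclideanSpace ℝ (Fin N) → ℝ)
    (ℓ : EuclideanSpace ℝ (Fin N) → ℝ)
    (hℓi : ∀ i, ContDiff ℝ 2 (ℓi i)) (hℓ : ContDiff ℝ 2 ℓ)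
    (R : EuclideanSpace ℝ (Fin N) → ℝ)
    (hR : R = fun θ => (1 / n : ℝ) * ∑ i, ℓi i θ)
    (θ : ℝ → EuclideanSpace ℝ (Fin N))
    (hθ : DifferentiableAt ℝ θ 0)
    (hstat : ∀ᶠ δ in nhds (0 : ℝ),
      gradient R (θ δ) + δ • gradient ℓ (θ δ) = 0)
    (H : EuclideanSpace ℝ (Fin N) ≃L[ℝ] EuclideanSpace ℝ (Fin N))
    (hH : (H : EuclideanSpace ℝ (Fin N) →L[ℝ] EuclideanSpace ℝ (Fin N)) =
      fderiv ℝ (gradient R) (θ 0))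
    (Ltest : EuclideanSpace ℝ (Fin N) → ℝ)
    (hLtest : DifferentiableAt ℝ Ltest (θ 0)) :
    deriv (fun δ => Ltest (θ δ)) 0 =
      ⟪gradient Ltest (θ 0), -(H.symm (gradient ℓ (θ 0)))⟫ := by
  have hRc : ContDiff ℝ 2 R := by
    rw [hR]
    exact contDiff_const.mul (ContDiff.sum fun i _ => hℓi i)
  have hgR := (differentiable_gradient_of_contDiff_two hRc) (θ 0)
  have hgl := (differentiable_gradient_of_contDiff_two hℓ) (θ 0)
  have hd := hθ.hasDerivAt
  have h1 : HasDerivAt (fun δ => gradient R (θ δ)) (H (deriv θ 0)) 0 := by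
    have h := hgR.hasFDerivAt.comp_hasDerivAt (0 : ℝ) hd
    rw [← hH] at h
    exact h
  have h2 : HasDerivAt (fun δ => gradient ℓ (θ δ))
      (fderiv ℝ (gradient ℓ) (θ 0) (deriv θ 0)) 0 :=
    hgl.hasFDerivAt.comp_hasDerivAt (0 : ℝ) hd
  have h3 := h1.add ((hasDerivAt_id (0 : ℝ)).smul h2)
  have h4 : HasDerivAt (fun _ : ℝ => (0 : EuclideanSpace ℝ (Fin N))) 0 0 :=
    hasDerivAt_const _ _
  have h5 := h3.unique (h4.congr_of_eventuallyEq hstat)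
  have h6 : H (deriv θ 0) = -gradient ℓ (θ 0) := by
    apply eq_neg_of_add_eq_zero_left
    simpa using h5
  have h7 : deriv θ 0 = -(H.symm (gradient ℓ (θ 0))) := by
    rw [← map_neg, ← h6, H.symm_apply_apply]
  have h8 : HasDerivAt (fun δ => Ltest (θ δ)) (fderiv ℝ Ltest (θ 0) (deriv θ 0)) 0 :=
    hLtest.hasFDerivAt.comp_hasDerivAt (0 : ℝ) hd
  rw [h8.deriv, ← h7]
  simp [gradient]
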